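/- arXiv:1207.5667 — 2 statements merged into one kernel-verified Lean document; each statement's English description precedes it below -/
import Mathlib

section
/- (Kakutani closedness) The set of semi-metrics on a fixed countable set X that embed isometrically into L¹ is closed under pointwise convergence: if d_n are L¹-embeddable semi-metrics on X converging pointwise to d, then d embeds isometrically into some L¹ space. -/
open MeasureTheory Filter

/-- A semi-metric `d` on `X` is `L¹`-embeddable if it is induced by a map into some
`L¹(Y,ν)`. -/
def L1Embeddable {X : Type} (d : X → X → ℝ) : Prop :=
  ∃ (Y : Type) (_ : MeasurableSpace Y) (ν : Measure Y) (f : X → Lp ℝ 1 ν),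
    ∀ x x', d x x' = ‖f x - f x'‖

/-- An `L¹`-embeddable semi-metric is represented by a finite measure on a compact product. -/
theorem l1_aux_repr {X : Type} [Countable X] (d : X → X → ℝ) (hd : L1Embeddable d) (x₀ : X)
    (c ε : X → ℝ) (hc : ∀ x, 0 < c x) (hε : Summable ε) (hε1 : ∑' x, ε x ≤ 1)
    (hcd : ∀ x, c x * d x x₀ ≤ ε x) :
    ∃ ρ : FiniteMeasure ((x : X) → Set.Icc (-(c x)⁻¹) ((c x)⁻¹)),
      ρ.mass ≤ 1 ∧ ∀ x x', d x x' = ∫ v : ((x : X) → Set.Icc (-(c x)⁻¹) ((c x)⁻¹)), |(v x : ℝ) - (v x' : ℝ)| ∂(ρ : Measure _) := by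
  obtain ⟨Y, mY, ν, f, hf⟩ := hd
  let T : X → Lp ℝ 1 ν := fun x => c x • |f x - f x₀|
  have hTn : ∀ x, ‖T x‖ ≤ ε x := by
    intro x
    have : ‖T x‖ = c x * d x x₀ := by
      simp only [T, norm_smul, norm_abs_eq_norm, hf, Real.norm_eq_abs, abs_of_pos (hc x)]
    rw [this]; exact hcd x
  have hTs : Summable T := Summable.of_norm_bounded hε hTn
  let G : Lp ℝ 1 ν := ∑' x, T x
  have hGn : ‖G‖ ≤ 1 := (tsum_of_norm_bounded hε.hasSum hTn).trans hε1
  have hTae : ∀ x, T x =ᵐ[ν] fun y => c x * |f x y - f x₀ y| := by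
    intro x
    filter_upwards [Lp.coeFn_smul (c x) (|f x - f x₀|), Lp.coeFn_abs (f x - f x₀),
      Lp.coeFn_sub (f x) (f x₀)] with y h1 h2 h3
    simp only [T]
    rw [h1, Pi.smul_apply, h2, h3, Pi.sub_apply, smul_eq_mul]
  have hT0 : ∀ x, 0 ≤ T x := by
    intro x
    rw [← Lp.coeFn_nonneg]
    filter_upwards [hTae x] with y h1
    rw [h1]
    exact mul_nonneg (hc x).le (abs_nonneg _)
  have hTG : ∀ x, T x ≤ G := fun x => hTs.le_tsum x (fun j _ => hT0 j)
  have hG0 : 0 ≤ G := (hT0 x₀).trans (hTG x₀)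
  have hGm : Measurable (G : Y → ℝ) := (Lp.stronglyMeasurable G).measurable
  have key : ∀ᵐ y ∂ν, 0 ≤ G y ∧ ∀ x, c x * |f x y - f x₀ y| ≤ G y := by
    have h1 : ∀ᵐ y ∂ν, ∀ x, c x * |f x y - f x₀ y| ≤ G y := by
      rw [ae_all_iff]
      intro x
      filter_upwards [hTae x, (Lp.coeFn_le _ _).2 (hTG x)] with y h1 h2
      rwa [← h1]
    filter_upwards [h1, (Lp.coeFn_nonneg _).2 hG0] with y h1 h2
    exact ⟨h2, h1⟩
  let μ : Measure Y := ν.withDensity (fun y => ENNReal.ofReal (G y))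
  have hle : ∀ x, -(c x)⁻¹ ≤ (c x)⁻¹ := fun x => by
    have := inv_pos.2 (hc x); linarith
  let V : Y → (x : X) → Set.Icc (-(c x)⁻¹) ((c x)⁻¹) := fun y x =>
    Set.projIcc _ _ (hle x) ((f x y - f x₀ y) / G y)
  have hV : Measurable V := by
    refine measurable_pi_iff.2 fun x => ?_
    exact continuous_projIcc.measurable.comp
      (((Lp.stronglyMeasurable (f x)).measurable.sub
        (Lp.stronglyMeasurable (f x₀)).measurable).div hGm)
  have hμ : μ Set.univ ≤ 1 := by
    have h1 : μ Set.univ = ∫⁻ y, ENNReal.ofReal (G y) ∂ν := by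
      simp [μ, withDensity_apply]
    rw [h1, ← ofReal_integral_eq_lintegral_ofReal (L1.integrable_coeFn G)
      ((Lp.coeFn_nonneg _).2 hG0)]
    refine ENNReal.ofReal_le_one.2 ?_
    refine le_trans ?_ hGn
    rw [L1.norm_eq_integral_norm]
    exact integral_mono (L1.integrable_coeFn G) (L1.integrable_coeFn G).norm
      (fun y => le_abs_self _)
  have hfin : IsFiniteMeasure μ := ⟨hμ.trans_lt ENNReal.one_lt_top⟩
  have hfin' : IsFiniteMeasure (μ.map V) := inferInstance
  refine ⟨⟨μ.map V, hfin'⟩, ?_, ?_⟩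
  · have : (μ.map V) Set.univ ≤ 1 := by
      rw [Measure.map_apply hV MeasurableSet.univ]; simpa using hμ
    have h2 := ENNReal.toNNReal_mono ENNReal.one_ne_top this
    simpa [FiniteMeasure.mass] using h2
  · intro x x'
    have hmeas : Measurable (fun v : (x : X) → Set.Icc (-(c x)⁻¹) ((c x)⁻¹) =>
        |(v x : ℝ) - (v x' : ℝ)|) := by fun_prop
    change _ = ∫ v, |(v x : ℝ) - (v x' : ℝ)| ∂(μ.map V)
    rw [integral_map hV.aemeasurable hmeas.aestronglyMeasurable]
    simp only [μ]
    rw [integral_withDensity_eq_integral_toReal_smul (by fun_prop)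
      (ae_of_all _ fun y => ENNReal.ofReal_lt_top)]
    rw [hf, L1.norm_eq_integral_norm]
    refine integral_congr_ae ?_
    filter_upwards [key, Lp.coeFn_sub (f x) (f x')] with y hy hs
    obtain ⟨hy0, hy⟩ := hy
    have hVx : ∀ z, G y * (V y z : ℝ) = f z y - f x₀ y := by
      intro z
      rcases hy0.eq_or_lt with h0 | h0
      · have := hy z
        rw [← h0] at this ⊢
        have h3 : |f z y - f x₀ y| ≤ 0 := by
          by_contra hcon
          push Not at hcon
          have := mul_pos (hc z) hcon
          linarith
        rw [zero_mul, abs_nonpos_iff.1 h3]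
      · have hm : (f z y - f x₀ y) / G y ∈ Set.Icc (-(c z)⁻¹) ((c z)⁻¹) := by
          rw [Set.mem_Icc, ← abs_le, abs_div, abs_of_pos h0, div_le_iff₀ h0, ← div_eq_inv_mul,
            le_div_iff₀ (hc z), mul_comm]
          exact hy z
        simp only [V]
        rw [Set.projIcc_of_mem _ hm]
        field_simp
    rw [hs, Pi.sub_apply, ENNReal.toReal_ofReal hy0, smul_eq_mul, Real.norm_eq_abs]
    have h4 : ∀ t : ℝ, G y * |t| = |G y * t| := fun t => by rw [abs_mul, abs_of_nonneg hy0]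
    rw [h4, mul_sub, hVx, hVx]
    congr 1; ring

/-- Kakutani closedness: on a countable set `X`, a pointwise limit of `L¹`-embeddable
semi-metrics is `L¹`-embeddable. -/
theorem l1_embeddable_closed_under_pointwise_limits {X : Type} [Countable X]
    (dseq : ℕ → X → X → ℝ) (d : X → X → ℝ)
    (hemb : ∀ n, L1Embeddable (dseq n))
    (hlim : ∀ x x', Tendsto (fun n => dseq n x x') atTop (nhds (d x x'))) :
    L1Embeddable d := by
  rcases isEmpty_or_nonempty X with hX | ⟨⟨x₀⟩⟩
  · exact ⟨Unit, inferInstance, 0, fun _ => 0, fun x => (hX.false x).elim⟩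
  obtain ⟨ε, hε0, s, hs, hs1⟩ := NNReal.exists_pos_sum_of_countable (one_ne_zero) X
  have hb : ∀ x, ∃ M : ℝ, 0 < M ∧ ∀ n, dseq n x x₀ ≤ M := by
    intro x
    obtain ⟨M, hM⟩ := (hlim x x₀).bddAbove_range
    exact ⟨max M 1, by positivity, fun n => (hM ⟨n, rfl⟩).trans (le_max_left _ _)⟩
  choose M hM0 hM using hb
  let c : X → ℝ := fun x => ε x / M x
  have hc : ∀ x, 0 < c x := fun x => div_pos (by exact_mod_cast hε0 x) (hM0 x)
  have hs' : HasSum (fun x => (ε x : ℝ)) s := by exact_mod_cast hs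
  have hcd : ∀ n x, c x * dseq n x x₀ ≤ ε x := by
    intro n x
    calc c x * dseq n x x₀ ≤ c x * M x := mul_le_mul_of_nonneg_left (hM x n) (hc x).le
      _ = ε x := div_mul_cancel₀ _ (hM0 x).ne'
  have hs1' : ∑' x, (ε x : ℝ) ≤ 1 := by rw [hs'.tsum_eq]; exact_mod_cast hs1.le
  choose ρ hρ1 hρ using fun n => l1_aux_repr (dseq n) (hemb n) x₀ c (fun x => ε x) hc
    hs'.summable hs1' (hcd n)
  obtain ⟨ρ', -, hρ'⟩ := (isCompact_setOfPred_finiteMeasure_le_of_compactSpace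
    ((x : X) → Set.Icc (-(c x)⁻¹) ((c x)⁻¹)) 1).ultrafilter_le_nhds
    ((hyperfilter ℕ).map ρ) (by
      rw [le_principal_iff]
      exact Eventually.of_forall (f := (hyperfilter ℕ : Filter ℕ)) hρ1)
  have hρt : Tendsto ρ (hyperfilter ℕ : Filter ℕ) (nhds ρ') := hρ'
  rw [FiniteMeasure.tendsto_iff_forall_integral_tendsto] at hρt
  have hd : ∀ x x', d x x' = ∫ v : ((x : X) → Set.Icc (-(c x)⁻¹) ((c x)⁻¹)), |(v x : ℝ) - (v x' : ℝ)| ∂(ρ' : Measure _) := by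
    intro x x'
    have h1 := hρt (BoundedContinuousFunction.mkOfCompact
      ⟨fun v => |(v x : ℝ) - (v x' : ℝ)|, by fun_prop⟩)
    have h2 := (hlim x x').mono_left (Nat.hyperfilter_le_atTop)
    refine tendsto_nhds_unique h2 (h1.congr fun n => ?_)
    rw [hρ n x x']; rfl
  let F : X → BoundedContinuousFunction ((x : X) → Set.Icc (-(c x)⁻¹) ((c x)⁻¹)) ℝ := fun x =>
    BoundedContinuousFunction.mkOfCompact ⟨fun v => (v x : ℝ), by fun_prop⟩
  have hF : ∀ x, MemLp (F x) 1 (ρ' : Measure _) := fun x =>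
    memLp_one_iff_integrable.2 ((F x).integrable _)
  refine ⟨((x : X) → Set.Icc (-(c x)⁻¹) ((c x)⁻¹)), inferInstance, (ρ' : Measure _), fun x => (hF x).toLp _, fun x x' => ?_⟩
  rw [hd, L1.norm_eq_integral_norm]
  refine integral_congr_ae ?_
  filter_upwards [Lp.coeFn_sub ((hF x).toLp _) ((hF x').toLp _), (hF x).coeFn_toLp,
    (hF x').coeFn_toLp] with v h1 h2 h3
  rw [h1, Pi.sub_apply, h2, h3]
  rfl
end

section
/- A semi-metric space (X, d) with X countable embeds isometrically into L¹ if and only if every finite subset of X embeds isometrically into L¹. -/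
open MeasureTheory

open scoped NNReal ENNReal Topology

/-- Compact box used to carry the limiting measure. -/
abbrev L1Box {X : Type} (b : X → ℝ≥0) : Type := ∀ x : X, Set.Icc (-(b x : ℝ)) (b x : ℝ)

lemma L1Box.continuous_abs {X : Type} (b : X → ℝ≥0) (x y : X) :
    Continuous (fun v : L1Box b => |(v x : ℝ) - (v y : ℝ)|) := by
  fun_prop

lemma L1_norm_sub_eq_integral {Y : Type} [MeasurableSpace Y] {ν : Measure Y} (f g : Lp ℝ 1 ν) :
    ‖f - g‖ = ∫ y, |f y - g y| ∂ν := by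
  rw [L1.norm_eq_integral_norm]
  refine integral_congr_ae ?_
  filter_upwards [Lp.coeFn_sub f g] with y hy
  rw [hy, Pi.sub_apply, Real.norm_eq_abs]

lemma exists_box_measure {X : Type} [Countable X] (d : X → X → ℝ) (x₀ : X) (δ : X → ℝ≥0)
    (hδ : ∀ x, 0 < δ x) (hsum : ∑' i, (ENNReal.ofReal (d i x₀) * δ i : ℝ≥0∞) < 1)
    (F : Finset X) (hx₀ : x₀ ∈ F) {Y : Type} [MeasurableSpace Y] (ν : Measure Y)
    (f : X → Lp ℝ 1 ν) (hf : ∀ x ∈ F, ∀ y ∈ F, d x y = ‖f x - f y‖) :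
    ∃ m : FiniteMeasure (L1Box fun x => (δ x)⁻¹), m.mass ≤ 1 ∧
      ∀ x ∈ F, ∀ y ∈ F, ∫ v : L1Box (fun x => (δ x)⁻¹), |(v x : ℝ) - (v y : ℝ)| ∂(m : Measure _) = d x y := by
  set u : X → Y → ℝ := fun x => (f x - f x₀ : Lp ℝ 1 ν) with hu
  have hum : ∀ x, Measurable (u x) := fun x => (Lp.stronglyMeasurable _).measurable
  set h : Y → ℝ≥0 := fun y => ∑ x ∈ F, δ x * ‖u x y‖₊ with hh
  have hhm : Measurable h := by
    refine Finset.measurable_sum _ fun x _ => ?_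
    exact (hum x).nnnorm.const_mul _
  have hle : ∀ x, -(((δ x)⁻¹ : ℝ≥0) : ℝ) ≤ (((δ x)⁻¹ : ℝ≥0) : ℝ) := fun x =>
    neg_le_self (NNReal.coe_nonneg _)
  set g : Y → L1Box (fun x => (δ x)⁻¹) := fun y x => Set.projIcc _ _ (hle x) (u x y / h y) with hg
  have hgm : Measurable g := by
    refine measurable_pi_lambda _ fun x => ?_
    exact continuous_projIcc.measurable.comp ((hum x).div hhm.coe_nnreal_real)
  have hpt : ∀ x ∈ F, ∀ y, (h y : ℝ) * (g y x : ℝ) = u x y := by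
    intro x hx y
    have h1 : δ x * ‖u x y‖₊ ≤ h y :=
      Finset.single_le_sum (f := fun x => δ x * ‖u x y‖₊) (fun _ _ => zero_le) hx
    have h1' : (δ x : ℝ) * |u x y| ≤ h y := by
      have := NNReal.coe_le_coe.2 h1
      simpa using this
    have hd : (0 : ℝ) < δ x := hδ x
    rcases eq_or_ne (h y) 0 with h0 | h0
    · rw [h0] at h1' ⊢
      have : |u x y| ≤ 0 := by
        by_contra hc
        push Not at hc
        have := mul_pos hd hc
        simp at h1'
        linarith
      have : u x y = 0 := abs_nonpos_iff.1 this
      simp [this]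
    · have hp : (0 : ℝ) < h y := NNReal.coe_pos.2 (pos_iff_ne_zero.2 h0)
      have hmem : u x y / h y ∈ Set.Icc (-(((δ x)⁻¹ : ℝ≥0) : ℝ)) (((δ x)⁻¹ : ℝ≥0) : ℝ) := by
        rw [Set.mem_Icc, ← abs_le, abs_div, abs_of_pos hp, NNReal.coe_inv, div_le_iff₀ hp,
          inv_mul_eq_div, le_div_iff₀ hd]
        linarith
      simp only [hg, Set.projIcc_of_mem (hle x) hmem]
      field_simp
  have hmass : ∫⁻ y, (h y : ℝ≥0∞) ∂ν ≤ 1 := by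
    have h2 : ∀ x ∈ F, ∫⁻ y, (δ x : ℝ≥0∞) * ‖u x y‖ₑ ∂ν = ENNReal.ofReal (d x x₀) * δ x := by
      intro x hx
      rw [lintegral_const_mul _ (hum x).enorm, mul_comm, hf x hx x₀ hx₀, L1.norm_def,
        ENNReal.ofReal_toReal]
      exact (L1.integrable_coeFn (f x - f x₀)).2.ne
    calc ∫⁻ y, (h y : ℝ≥0∞) ∂ν = ∫⁻ y, ∑ x ∈ F, (δ x : ℝ≥0∞) * ‖u x y‖ₑ ∂ν := by
          refine lintegral_congr fun y => ?_
          simp [hh, enorm_eq_nnnorm]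
      _ = ∑ x ∈ F, ENNReal.ofReal (d x x₀) * δ x := by
          rw [lintegral_finsetSum _ fun x _ => (hum x).enorm.const_mul _]
          exact Finset.sum_congr rfl h2
      _ ≤ 1 := (ENNReal.sum_le_tsum F).trans hsum.le
  set m : Measure (L1Box fun x => (δ x)⁻¹) :=
    (ν.withDensity fun y => (h y : ℝ≥0∞)).map g with hm
  have hmu : m Set.univ ≤ 1 := by
    rw [hm, Measure.map_apply hgm MeasurableSet.univ, Set.preimage_univ,
      withDensity_apply _ MeasurableSet.univ, Measure.restrict_univ]
    exact hmass
  have hfin : IsFiniteMeasure m := ⟨hmu.trans_lt ENNReal.one_lt_top⟩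
  refine ⟨⟨m, hfin⟩, ?_, ?_⟩
  · exact ENNReal.coe_le_coe.1 ((FiniteMeasure.ennreal_mass (μ := ⟨m, hfin⟩)).trans_le hmu)
  · intro x hx y hy
    change ∫ v : L1Box (fun x => (δ x)⁻¹), |(v x : ℝ) - (v y : ℝ)| ∂m = d x y
    rw [hm, integral_map hgm.aemeasurable
      (L1Box.continuous_abs _ x y).measurable.aestronglyMeasurable,
      integral_withDensity_eq_integral_smul hhm, hf x hx y hy]
    have : f x - f y = (f x - f x₀) - (f y - f x₀) := by abel
    rw [this, L1_norm_sub_eq_integral]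
    refine integral_congr_ae (Filter.Eventually.of_forall fun z => ?_)
    change (h z : ℝ≥0) • |(g z x : ℝ) - (g z y : ℝ)| = |u x z - u y z|
    rw [← hpt x hx z, ← hpt y hy z, ← mul_sub, abs_mul, abs_of_nonneg (NNReal.coe_nonneg _),
      NNReal.smul_def, smul_eq_mul]

/-- A countable semi-metric space `(X,d)` embeds isometrically into `L¹` if and only if
every finite subset of `X` embeds isometrically into `L¹`. -/
theorem l1_embeddable_iff_finite_subsets {X : Type} [Countable X]
    (d : X → X → ℝ)
    (hself : ∀ x, d x x = 0) (hsymm : ∀ x y, d x y = d y x)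
    (htri : ∀ x y z, d x z ≤ d x y + d y z) :
    L1Embeddable d ↔
      ∀ F : Finset X, ∃ (Y : Type) (_ : MeasurableSpace Y) (ν : Measure Y)
        (f : X → Lp ℝ 1 ν), ∀ x ∈ F, ∀ y ∈ F, d x y = ‖f x - f y‖ := by
  classical
  constructor
  · rintro ⟨Y, mY, ν, f, hf⟩ F
    exact ⟨Y, mY, ν, f, fun x _ y _ => hf x y⟩
  intro H
  rcases isEmpty_or_nonempty X with hX | ⟨⟨x₀⟩⟩
  · exact ⟨Unit, inferInstance, 0, fun x => isEmptyElim x, fun x => isEmptyElim x⟩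
  obtain ⟨δ, hδ, hsum⟩ := ENNReal.exists_pos_tsum_mul_lt_of_countable one_ne_zero
    (fun i : X => ENNReal.ofReal (d i x₀)) (fun i => ENNReal.ofReal_ne_top)
  have key : ∀ F : Finset X, ∃ m : FiniteMeasure (L1Box fun x => (δ x)⁻¹), m.mass ≤ 1 ∧
      ∀ x ∈ F, ∀ y ∈ F, ∫ v : L1Box (fun x => (δ x)⁻¹), |(v x : ℝ) - (v y : ℝ)| ∂(m : Measure _) = d x y := by
    intro F
    obtain ⟨Y, mY, ν, f, hf⟩ := H (insert x₀ F)
    obtain ⟨m, h1, h2⟩ := exists_box_measure d x₀ δ hδ hsum (insert x₀ F)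
      (Finset.mem_insert_self _ _) ν f hf
    exact ⟨m, h1, fun x hx y hy =>
      h2 x (Finset.mem_insert_of_mem hx) y (Finset.mem_insert_of_mem hy)⟩
  choose m hm1 hm2 using key
  obtain ⟨μ, -, hμ⟩ := isCompact_iff_ultrafilter_le_nhds.1
    (isCompact_setOfPred_finiteMeasure_le_of_compactSpace (L1Box fun x => (δ x)⁻¹) 1)
    ((Ultrafilter.of (Filter.atTop : Filter (Finset X))).map m)
    (by
      rw [Filter.le_principal_iff]
      change ∀ᶠ F in (Ultrafilter.of (Filter.atTop : Filter (Finset X)) : Filter (Finset X)),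
        (m F).mass ≤ 1
      exact Filter.Eventually.of_forall hm1)
  have hlim : Filter.Tendsto m (Ultrafilter.of (Filter.atTop : Filter (Finset X))) (𝓝 μ) := hμ
  rw [FiniteMeasure.tendsto_iff_forall_integral_tendsto] at hlim
  have hint : ∀ x y, ∫ v : L1Box (fun x => (δ x)⁻¹), |(v x : ℝ) - (v y : ℝ)| ∂(μ : Measure _) = d x y := by
    intro x y
    have h1 := hlim (BoundedContinuousFunction.mkOfCompact
      ⟨_, L1Box.continuous_abs (fun x => (δ x)⁻¹) x y⟩)
    refine tendsto_nhds_unique h1 (tendsto_const_nhds.congr' ?_)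
    have h2 : ∀ᶠ F in (Filter.atTop : Filter (Finset X)), {x, y} ≤ F :=
      Filter.eventually_ge_atTop _
    filter_upwards [Ultrafilter.of_le _ h2] with F hF
    exact (hm2 F x (hF (by simp)) y (hF (by simp))).symm
  have hLp : ∀ x, MemLp (fun v : L1Box (fun x => (δ x)⁻¹) => (v x : ℝ)) 1 (μ : Measure _) := by
    intro x
    refine MemLp.of_bound (C := ((δ x)⁻¹ : ℝ≥0)) ?_ (Filter.Eventually.of_forall fun v => ?_)
    · exact (by fun_prop : Continuous fun v : L1Box (fun x => (δ x)⁻¹) =>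
        (v x : ℝ)).measurable.aestronglyMeasurable
    · rw [Real.norm_eq_abs, abs_le]
      exact (v x).2
  refine ⟨L1Box fun x => (δ x)⁻¹, inferInstance, μ, fun x => (hLp x).toLp, fun x y => ?_⟩
  rw [L1_norm_sub_eq_integral, ← hint x y]
  refine integral_congr_ae ?_
  filter_upwards [(hLp x).coeFn_toLp, (hLp y).coeFn_toLp] with v h1 h2
  rw [h1, h2]
end
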